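/- Let p be a real number with 1 < p ≤ 2 and let q = p/(p−1). Let A be a relatively compact subset of ℓ^p with d(A) > 0. Then r(A) < 2^(−1/q) · d(A). -/

import Mathlib

open scoped ENNReal

noncomputable def chebRadius {p : ℝ≥0∞} [Fact (1 ≤ p)]
    (A : Set (lp (fun _ : ℕ => ℝ) p)) : ℝ :=
  ⨅ y : lp (fun _ : ℕ => ℝ) p, ⨆ x : A, ‖(x : lp (fun _ : ℕ => ℝ) p) - y‖

lemma abs_rpow_mul_self_of_nonneg {p a : ℝ} (hp : 1 < p) (ha : 0 ≤ a) :
    |a| ^ (p - 2) * a = a ^ (p - 1) := by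
  rcases ha.eq_or_lt with rfl | h
  · rw [mul_zero, Real.zero_rpow (by linarith)]
  · rw [abs_of_pos h, ← Real.rpow_add_one h.ne']
    ring_nf

lemma rpow_add_rpow_le_two_rpow_mul {s a b : ℝ} (hs0 : 0 < s) (hs1 : s ≤ 1) (ha : 0 ≤ a)
    (hb : 0 ≤ b) : a ^ s + b ^ s ≤ 2 ^ (1 - s) * (a + b) ^ s := by
  have h := (Real.concaveOn_rpow hs0.le hs1).2 (Set.mem_Ici.2 ha) (Set.mem_Ici.2 hb)
    (by norm_num : (0 : ℝ) ≤ 1 / 2) (by norm_num : (0 : ℝ) ≤ 1 / 2) (by norm_num)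
  simp only [smul_eq_mul] at h
  rw [show 1 / 2 * a + 1 / 2 * b = (a + b) / 2 by ring,
    Real.div_rpow (by positivity) (by norm_num)] at h
  rw [Real.rpow_sub (by norm_num), Real.rpow_one, div_mul_eq_mul_div]
  have h2 : 2 * (a + b) ^ s / 2 ^ s = 2 * ((a + b) ^ s / 2 ^ s) := by ring
  rw [h2]
  linarith

/-- The duality map `a ↦ |a| ^ (p - 2) * a` is Hölder with sharp constant `2 ^ (2 - p)`. -/
lemma sub_mul_abs_rpow_mul_sub_le {p : ℝ} (hp1 : 1 < p) (hp2 : p ≤ 2) (a b : ℝ) :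
    (a - b) * (|a| ^ (p - 2) * a - |b| ^ (p - 2) * b) ≤ 2 ^ (2 - p) * |a - b| ^ p := by
  have one_le : (1 : ℝ) ≤ 2 ^ (2 - p) := Real.one_le_rpow (by norm_num) (by linarith)
  have finish : ∀ d e : ℝ, 0 ≤ d → e ≤ 2 ^ (2 - p) * d ^ (p - 1) →
      d * e ≤ 2 ^ (2 - p) * |d| ^ p := by
    intro d e hd he
    have h1 : d ^ p = d * d ^ (p - 1) := by
      rw [Real.rpow_sub_one' hd (by linarith)]
      rcases hd.eq_or_lt with rfl | h
      · simp [Real.zero_rpow (by linarith : p ≠ 0)]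
      · field_simp
    rw [abs_of_nonneg hd, h1]
    nlinarith [mul_le_mul_of_nonneg_left he hd]
  have nonneg_case : ∀ a b : ℝ, 0 ≤ b → b ≤ a →
      (a - b) * (|a| ^ (p - 2) * a - |b| ^ (p - 2) * b) ≤ 2 ^ (2 - p) * |a - b| ^ p := by
    intro a b hb hab
    refine finish _ _ (by linarith) ?_
    rw [abs_rpow_mul_self_of_nonneg hp1 hb, abs_rpow_mul_self_of_nonneg hp1 (hb.trans hab)]
    have h := Real.rpow_add_le_add_rpow (p := p - 1) (sub_nonneg.2 hab) hb (by linarith)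
      (by linarith)
    rw [sub_add_cancel] at h
    have h0 : 0 ≤ (a - b) ^ (p - 1) := Real.rpow_nonneg (by linarith) _
    nlinarith
  wlog hab : b ≤ a generalizing a b
  · have := this b a (le_of_not_ge hab)
    rw [abs_sub_comm] at this
    linarith
  rcases le_total 0 b with hb | hb
  · exact nonneg_case a b hb hab
  rcases le_total a 0 with ha | ha
  · have := nonneg_case (-b) (-a) (by linarith) (by linarith)
    rw [abs_neg, abs_neg, show -b - -a = a - b by ring] at this
    linarith
  refine finish _ _ (by linarith) ?_
  have hb' := abs_rpow_mul_self_of_nonneg hp1 (neg_nonneg.2 hb)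
  have ha' := abs_rpow_mul_self_of_nonneg hp1 ha
  have h := rpow_add_rpow_le_two_rpow_mul (s := p - 1) (by linarith) (by linarith) ha
    (neg_nonneg.2 hb)
  rw [abs_neg] at hb'
  rw [show 1 - (p - 1) = 2 - p by ring, ← sub_eq_add_neg] at h
  linarith

lemma continuous_abs_rpow_mul_self {p : ℝ} (hp : 1 < p) :
    Continuous fun a : ℝ => |a| ^ (p - 2) * a := by
  have h := (contDiff_norm_rpow (E := ℝ) hp).continuous_deriv le_rfl
  have h2 : (fun a : ℝ => |a| ^ (p - 2) * a) = fun a => p⁻¹ * deriv (fun x : ℝ => ‖x‖ ^ p) a := by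
    ext a
    rw [(hasDerivAt_norm_rpow a hp).deriv, Real.norm_eq_abs]
    field_simp
  rw [h2]
  exact continuous_const.mul h

lemma exists_sum_mul_abs_sub_rpow_le {ι : Type*} [Fintype ι] {p : ℝ} (hp1 : 1 < p) (hp2 : p ≤ 2)
    (x t : ι → ℝ) (ht : ∀ i, 0 ≤ t i) (ht1 : ∑ i, t i = 1) :
    ∃ c, ∑ i, t i * |x i - c| ^ p ≤ 2 ^ (1 - p) * ∑ i, ∑ j, t i * t j * |x i - x j| ^ p := by
  set φ : ℝ → ℝ := fun a => |a| ^ (p - 2) * a with hφ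
  have φ_nonneg : ∀ a, 0 ≤ a → 0 ≤ φ a := fun a ha => by positivity
  have φ_nonpos : ∀ a, a ≤ 0 → φ a ≤ 0 := fun a ha =>
    mul_nonpos_of_nonneg_of_nonpos (by positivity) ha
  have hM : ∀ i, |x i| ≤ ∑ i, |x i| := fun i =>
    Finset.single_le_sum (f := fun i => |x i|) (fun _ _ => abs_nonneg _) (Finset.mem_univ i)
  set M := ∑ i, |x i|
  have hM0 : 0 ≤ M := Finset.sum_nonneg fun _ _ => abs_nonneg _
  have hcont : Continuous fun c => ∑ i, t i * φ (x i - c) := by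
    have := continuous_abs_rpow_mul_self hp1
    fun_prop
  obtain ⟨c, -, hc⟩ := intermediate_value_Icc' (neg_le_self hM0) hcont.continuousOn
    (show (0 : ℝ) ∈ _ from
      ⟨Finset.sum_nonpos fun i _ => mul_nonpos_of_nonneg_of_nonpos (ht i)
          (φ_nonpos _ (by linarith [hM i, le_abs_self (x i)])),
        Finset.sum_nonneg fun i _ => mul_nonneg (ht i)
          (φ_nonneg _ (by linarith [hM i, neg_abs_le (x i)]))⟩)
  refine ⟨c, ?_⟩
  set y : ι → ℝ := fun i => x i - c with hy
  have hc' : ∑ i, t i * φ (y i) = 0 := hc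
  have hyφ : ∀ i, y i * φ (y i) = |y i| ^ p := by
    intro i
    have : y i * φ (y i) = |y i| ^ (p - 2) * |y i| ^ (2 : ℝ) := by
      rw [Real.rpow_two, sq_abs]
      ring
    rw [this, ← Real.rpow_add' (abs_nonneg _) (by linarith)]
    ring_nf
  have key : ∑ i, ∑ j, t i * t j * ((y i - y j) * (φ (y i) - φ (y j)))
      = 2 * ∑ i, t i * |y i| ^ p := by
    have : ∀ i j, t i * t j * ((y i - y j) * (φ (y i) - φ (y j))) =
        (t i * |y i| ^ p) * t j + t i * (t j * |y j| ^ p)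
          - (t i * y i) * (t j * φ (y j)) - (t i * φ (y i)) * (t j * y j) := by
      intro i j
      rw [← hyφ, ← hyφ]
      ring
    simp only [this, Finset.sum_sub_distrib, Finset.sum_add_distrib, ← Finset.sum_mul_sum, hc', ht1]
    ring
  have le : ∑ i, ∑ j, t i * t j * ((y i - y j) * (φ (y i) - φ (y j)))
      ≤ ∑ i, ∑ j, 2 ^ (2 - p) * (t i * t j * |x i - x j| ^ p) := by
    refine Finset.sum_le_sum fun i _ => Finset.sum_le_sum fun j _ => ?_
    have h := sub_mul_abs_rpow_mul_sub_le hp1 hp2 (y i) (y j)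
    have hxy : y i - y j = x i - x j := by simp [hy]
    have := mul_le_mul_of_nonneg_left h (mul_nonneg (ht i) (ht j))
    rw [← hxy]
    linarith
  simp only [← Finset.mul_sum] at le
  rw [key, show (2 : ℝ) - p = 1 + (1 - p) by ring, Real.rpow_add (by norm_num),
    Real.rpow_one] at le
  change ∑ i, t i * |y i| ^ p ≤ _
  linarith

lemma lp.exists_sum_mul_norm_sub_rpow_le {α ι : Type*} [Fintype ι] {p : ℝ} (hp1 : 1 < p)
    (hp2 : p ≤ 2) (x : ι → lp (fun _ : α => ℝ) (ENNReal.ofReal p)) (t : ι → ℝ)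
    (ht : ∀ i, 0 ≤ t i) (ht1 : ∑ i, t i = 1) :
    ∃ y : lp (fun _ : α => ℝ) (ENNReal.ofReal p), ∑ i, t i * ‖x i - y‖ ^ p ≤
      2 ^ (1 - p) * ∑ i, ∑ j, t i * t j * ‖x i - x j‖ ^ p := by
  have hp0 : 0 < p := by linarith
  have htr : (ENNReal.ofReal p).toReal = p := ENNReal.toReal_ofReal hp0.le
  have hasSum : ∀ z : lp (fun _ : α => ℝ) (ENNReal.ofReal p),
      HasSum (fun k => |z k| ^ p) (‖z‖ ^ p) := by
    intro z
    have := lp.hasSum_norm (by rwa [htr]) z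
    simpa only [htr, Real.norm_eq_abs] using this
  choose c hc using fun k => exists_sum_mul_abs_sub_rpow_le hp1 hp2 (fun i => x i k) t ht ht1
  have hright : HasSum (fun k => 2 ^ (1 - p) * ∑ i, ∑ j, t i * t j * |x i k - x j k| ^ p)
      (2 ^ (1 - p) * ∑ i, ∑ j, t i * t j * ‖x i - x j‖ ^ p) :=
    (hasSum_sum fun i _ => hasSum_sum fun j _ => (hasSum (x i - x j)).mul_left _).mul_left _
  obtain ⟨i₀, hi₀⟩ : ∃ i, 0 < t i := by
    by_contra! h
    have : ∑ i, t i ≤ 0 := Finset.sum_nonpos fun i _ => h i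
    linarith
  have hmem : Memℓp (fun k => x i₀ k - c k) (ENNReal.ofReal p) := by
    refine memℓp_gen ?_
    simp only [htr, Real.norm_eq_abs]
    refine Summable.of_nonneg_of_le (fun k => by positivity) (fun k => ?_)
      (hright.summable.mul_left (t i₀)⁻¹)
    rw [le_inv_mul_iff₀ hi₀]
    exact (Finset.single_le_sum (f := fun i => t i * |x i k - c k| ^ p)
      (fun i _ => mul_nonneg (ht i) (by positivity)) (Finset.mem_univ i₀)).trans (hc k)
  let z : lp (fun _ : α => ℝ) (ENNReal.ofReal p) := ⟨_, hmem⟩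
  refine ⟨x i₀ - z, ?_⟩
  have hleft : HasSum (fun k => ∑ i, t i * |x i k - c k| ^ p)
      (∑ i, t i * ‖x i - (x i₀ - z)‖ ^ p) := by
    refine hasSum_sum fun i _ => ?_
    have hk : ∀ k, x i k - c k = (x i - (x i₀ - z)) k := fun k => by
      change _ = x i k - (x i₀ k - (x i₀ k - c k))
      ring
    simp only [hk]
    exact (hasSum _).mul_left _
  exact hasSum_le hc hleft hright

/-- A finite minimax principle: if every weighted average of finitely many convex functions takes
a value at most `C`, then the functions are simultaneously below any `C' > C` somewhere. -/
lemma exists_forall_lt_of_forall_weights {E ι : Type*} [AddCommGroup E] [Module ℝ E] [Fintype ι]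
    [Nonempty E] (f : ι → E → ℝ) (hf : ∀ i, ConvexOn ℝ Set.univ (f i)) {C C' : ℝ} (hC : C < C')
    (h : ∀ t : ι → ℝ, (∀ i, 0 ≤ t i) → ∑ i, t i = 1 → ∃ y, ∑ i, t i * f i y ≤ C) :
    ∃ y, ∀ i, f i y < C' := by
  classical
  by_contra! hcon
  let S : Set (ι → ℝ) := {v | ∃ y, ∀ i, f i y < v i}
  have hSconv : Convex ℝ S := by
    rintro v ⟨y, hy⟩ w ⟨z, hz⟩ a b ha hb hab
    refine ⟨a • y + b • z, fun i => ?_⟩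
    refine ((hf i).2 (Set.mem_univ y) (Set.mem_univ z) ha hb hab).trans_lt ?_
    simp only [smul_eq_mul, Pi.add_apply, Pi.smul_apply]
    rcases ha.eq_or_lt with rfl | ha
    · have : b = 1 := by linarith
      subst this
      simpa using hz i
    · exact add_lt_add_of_lt_of_le (mul_lt_mul_of_pos_left (hy i) ha)
        (mul_le_mul_of_nonneg_left (hz i).le hb)
  have hSopen : IsOpen S := by
    have : S = ⋃ y, ⋂ i, {v : ι → ℝ | f i y < v i} := by
      ext v
      simp [S]
    rw [this]
    exact isOpen_iUnion fun y => isOpen_iInter_of_finite fun i =>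
      isOpen_lt continuous_const (continuous_apply i)
  have hnot : (fun _ => C') ∉ S := by
    rintro ⟨y, hy⟩
    obtain ⟨i, hi⟩ := hcon y
    exact absurd (hy i) (not_lt.2 hi)
  obtain ⟨g, hg⟩ := geometric_hahn_banach_point_open hSconv hSopen hnot
  let s : ι → ℝ := fun i => g (Pi.single i 1)
  have hgs : ∀ v : ι → ℝ, g v = ∑ i, s i * v i := by
    intro v
    conv_lhs => rw [pi_eq_sum_univ' v]
    simp only [map_sum, map_smul, smul_eq_mul, s, mul_comm]
  obtain ⟨y₀⟩ := ‹Nonempty E›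
  have hs : ∀ i, 0 ≤ s i := by
    intro i
    by_contra! hi
    let v : ι → ℝ := fun j => f j y₀ + 1
    have hR : ∀ R : ℝ, 0 ≤ R → g (fun _ => C') < g v + R * s i := by
      intro R hR
      have := hg (v + R • Pi.single i 1) ⟨y₀, fun j => by
        have : 0 ≤ (Pi.single i (1 : ℝ) : ι → ℝ) j := by
          by_cases hj : j = i
          · subst hj; simp
          · simp [hj]
        simp only [v, Pi.add_apply, Pi.smul_apply, smul_eq_mul]
        nlinarith [mul_nonneg hR this]⟩
      simpa [s] using this
    have h0 := hR 0 le_rfl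
    have := hR ((g (fun _ => C') - g v) / s i)
      (div_nonneg_of_nonpos (by linarith) hi.le)
    rw [div_mul_cancel₀ _ hi.ne] at this
    linarith
  have hle : ∀ y, C' * ∑ i, s i ≤ ∑ i, s i * f i y := by
    intro y
    have h1 : ∀ ε : ℝ, 0 < ε → C' * ∑ i, s i ≤ ∑ i, s i * f i y + ε * ∑ i, s i := by
      intro ε hε
      have := hg (fun i => f i y + ε) ⟨y, fun i => by linarith⟩
      rw [hgs, hgs] at this
      simp only [mul_add, Finset.sum_add_distrib, ← Finset.sum_mul] at this
      linarith
    have hT : 0 ≤ ∑ i, s i := Finset.sum_nonneg fun i _ => hs i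
    refine le_of_forall_pos_le_add fun ε hε => ?_
    have h2 := h1 (ε / (∑ i, s i + 1)) (by positivity)
    have h3 : ε / (∑ i, s i + 1) * ∑ i, s i ≤ ε := by
      rw [div_mul_eq_mul_div, div_le_iff₀ (by positivity)]
      nlinarith
    linarith
  have hT : 0 < ∑ i, s i := by
    refine lt_of_le_of_ne (Finset.sum_nonneg fun i _ => hs i) fun h0 => ?_
    have hz : ∀ i, s i = 0 := fun i =>
      (Finset.sum_eq_zero_iff_of_nonneg fun i _ => hs i).1 h0.symm i (Finset.mem_univ i)
    have := hg (fun i => f i y₀ + 1) ⟨y₀, fun i => by linarith⟩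
    rw [hgs, hgs] at this
    simp [hz] at this
  obtain ⟨y, hy⟩ := h (fun i => s i / ∑ i, s i) (fun i => div_nonneg (hs i) hT.le)
    (by rw [← Finset.sum_div, div_self hT.ne'])
  simp only [div_mul_eq_mul_div, ← Finset.sum_div] at hy
  rw [div_le_iff₀ hT] at hy
  nlinarith [hle y]

/-- Averages of `D i j ≤ d` gain a fixed amount when points in the same one of finitely many cells
satisfy `D i j ≤ d / 2`. -/
lemma sum_mul_le_of_cells {ι κ : Type*} [Fintype ι] [Fintype κ] [Nonempty κ] (g : ι → κ)
    (D : ι → ι → ℝ) {d : ℝ} (hd : 0 ≤ d) (hD : ∀ i j, D i j ≤ d)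
    (hcell : ∀ i j, g i = g j → D i j ≤ d / 2) (t : ι → ℝ) (ht : ∀ i, 0 ≤ t i)
    (ht1 : ∑ i, t i = 1) :
    ∑ i, ∑ j, t i * t j * D i j ≤ d * (1 - 1 / (2 * Fintype.card κ)) := by
  classical
  have hN : (0 : ℝ) < Fintype.card κ := by exact_mod_cast Fintype.card_pos
  let e : ι → κ → ℝ := fun i k => if g i = k then t i else 0
  have he : ∀ i, ∑ k, e i k = t i := fun i => by simp [e]
  have hsq : ∑ k, (∑ i, e i k) ^ 2 = ∑ i, ∑ j, if g i = g j then t i * t j else 0 := by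
    simp only [sq, Finset.sum_mul_sum]
    rw [Finset.sum_comm]
    refine Finset.sum_congr rfl fun i _ => ?_
    rw [Finset.sum_comm]
    refine Finset.sum_congr rfl fun j _ => ?_
    simp [e, eq_comm]
  have hcs : 1 ≤ Fintype.card κ * ∑ k, (∑ i, e i k) ^ 2 := by
    have h := sq_sum_le_card_mul_sum_sq (s := Finset.univ) (f := fun k => ∑ i, e i k)
    rw [Finset.sum_comm] at h
    simpa [he, ht1] using h
  have hle : ∑ i, ∑ j, t i * t j * D i j ≤
      ∑ i, ∑ j, (d * (t i * t j) - d / 2 * if g i = g j then t i * t j else 0) := by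
    refine Finset.sum_le_sum fun i _ => Finset.sum_le_sum fun j _ => ?_
    have h0 := mul_nonneg (ht i) (ht j)
    split_ifs with hij
    · nlinarith [hcell i j hij]
    · nlinarith [hD i j]
  refine hle.trans ?_
  simp only [Finset.sum_sub_distrib, ← Finset.mul_sum, ← Finset.sum_mul, ht1, ← hsq]
  have h1 : 1 / (Fintype.card κ : ℝ) ≤ ∑ k, (∑ i, e i k) ^ 2 := by
    rwa [div_le_iff₀' hN]
  have h2 : 1 / (2 * (Fintype.card κ : ℝ)) = 1 / Fintype.card κ / 2 := by
    field_simp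
  rw [h2]
  nlinarith

lemma convexOn_norm_sub_rpow {E : Type*} [NormedAddCommGroup E] [NormedSpace ℝ E] {p : ℝ}
    (hp : 1 ≤ p) (x : E) : ConvexOn ℝ Set.univ fun y => ‖x - y‖ ^ p := by
  refine ⟨convex_univ, fun y _ z _ a b ha hb hab => ?_⟩
  have h1 : ‖x - (a • y + b • z)‖ ≤ a • ‖x - y‖ + b • ‖x - z‖ := by
    have : x - (a • y + b • z) = a • (x - y) + b • (x - z) := by
      rw [smul_sub, smul_sub, sub_add_sub_comm, ← add_smul, hab, one_smul]
    rw [this]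
    refine (norm_add_le _ _).trans_eq ?_
    rw [norm_smul, norm_smul, Real.norm_of_nonneg ha, Real.norm_of_nonneg hb]
    rfl
  exact (Real.rpow_le_rpow (norm_nonneg _) h1 (by linarith)).trans
    ((convexOn_rpow hp).2 (norm_nonneg (x - y)) (norm_nonneg (x - z)) ha hb hab)

lemma chebRadius_le {p : ℝ≥0∞} [Fact (1 ≤ p)] {A : Set (lp (fun _ : ℕ => ℝ) p)}
    (y : lp (fun _ : ℕ => ℝ) p) {R : ℝ} (hR : 0 ≤ R) (h : ∀ x ∈ A, ‖x - y‖ ≤ R) :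
    chebRadius A ≤ R :=
  (ciInf_le ⟨0, by rintro _ ⟨z, rfl⟩; exact Real.iSup_nonneg fun _ => norm_nonneg _⟩ y).trans
    (Real.iSup_le (fun x => h x x.2) hR)

theorem gulevich_small_p (p q : ℝ) (hp1 : 1 < p) (hp2 : p ≤ 2)
    (hq : q = p / (p - 1)) [Fact (1 ≤ ENNReal.ofReal p)]
    (A : Set (lp (fun _ : ℕ => ℝ) (ENNReal.ofReal p)))
    (hcpt : IsCompact (closure A)) (hd : 0 < Metric.diam A) :
    chebRadius A < 2 ^ (-(1 / q)) * Metric.diam A := by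
  have hp0 : 0 < p := by linarith
  have htb : TotallyBounded A := hcpt.totallyBounded.subset subset_closure
  have hbdd : Bornology.IsBounded A := htb.isBounded
  obtain ⟨a, ha⟩ : A.Nonempty := by
    by_contra h
    rw [Set.not_nonempty_iff_eq_empty.1 h, Metric.diam_empty] at hd
    exact hd.false
  set d := Metric.diam A
  obtain ⟨K, -, hK, hAK⟩ := Metric.finite_approx_of_totallyBounded htb (d / 4) (by positivity)
  have := hK.fintype
  have hcov : ∀ x ∈ A, ∃ k : K, dist x k < d / 4 := by
    intro x hx
    simpa using hAK hx
  have : Nonempty K := (hcov a ha).nonempty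
  set N : ℝ := (Fintype.card K : ℝ)
  have hN : 1 ≤ N := Nat.one_le_cast.2 Fintype.card_pos
  set C : ℝ := 2 ^ (1 - p) * (d ^ p * (1 - 1 / (2 * N)))
  have hfrac : 0 < 1 / (2 * N) ∧ 1 / (2 * N) < 1 :=
    ⟨by positivity, by rw [div_lt_one (by positivity)]; linarith⟩
  have hC0 : 0 ≤ C := by
    have : 0 ≤ 1 - 1 / (2 * N) := by linarith
    positivity
  have hT : (2 ^ (-(1 / q)) * d) ^ p = 2 ^ (1 - p) * d ^ p := by
    rw [Real.mul_rpow (by positivity) hd.le, ← Real.rpow_mul (by norm_num)]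
    congr 2
    have : p - 1 ≠ 0 := by linarith
    rw [hq]
    field_simp
    ring
  set T := 2 ^ (-(1 / q)) * d
  have hT0 : 0 < T := by positivity
  have hCT : C < T ^ p := by
    rw [hT]
    have : d ^ p * (1 - 1 / (2 * N)) < d ^ p := by
      have : 0 < d ^ p := by positivity
      nlinarith
    exact mul_lt_mul_of_pos_left this (by positivity)
  have hCT' : C ^ (1 / p) < T := by
    rw [one_div, Real.rpow_inv_lt_iff_of_pos hC0 hT0.le hp0]
    exact hCT
  obtain ⟨R, hCR, hRT⟩ := exists_between hCT'
  obtain ⟨T', hRT', hTT'⟩ := exists_between hRT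
  have hR0 : 0 ≤ R := (Real.rpow_nonneg hC0 _).trans hCR.le
  have hCR' : C < R ^ p := by
    rwa [one_div, Real.rpow_inv_lt_iff_of_pos hC0 hR0 hp0] at hCR
  obtain ⟨F, hFA, hF, hAF⟩ := Metric.finite_approx_of_totallyBounded htb (T' - R) (by linarith)
  have := hF.fintype
  choose g hg using fun x : F => hcov x (hFA x.2)
  obtain ⟨y, hy⟩ : ∃ y, ∀ x : F,
      ‖(x : lp (fun _ : ℕ => ℝ) (ENNReal.ofReal p)) - y‖ ^ p < R ^ p := by
    refine exists_forall_lt_of_forall_weights _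
      (fun x : F => convexOn_norm_sub_rpow hp1.le _) hCR' fun t ht ht1 => ?_
    obtain ⟨y, hy⟩ := lp.exists_sum_mul_norm_sub_rpow_le hp1 hp2
      (fun x : F => (x : lp (fun _ : ℕ => ℝ) (ENNReal.ofReal p))) t ht ht1
    refine ⟨y, hy.trans (mul_le_mul_of_nonneg_left ?_ (by positivity))⟩
    refine sum_mul_le_of_cells g _ (by positivity) (fun i j => ?_) (fun i j hij => ?_) t ht ht1
    · rw [← dist_eq_norm]
      exact Real.rpow_le_rpow dist_nonneg
        (Metric.dist_le_diam_of_mem hbdd (hFA i.2) (hFA j.2)) hp0.le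
    · have h1 : ‖(i : lp (fun _ : ℕ => ℝ) (ENNReal.ofReal p)) - j‖ ≤ d / 2 := by
        have hi := hg i
        have hj := hg j
        rw [← hij, dist_comm] at hj
        rw [← dist_eq_norm]
        linarith [dist_triangle (i : lp (fun _ : ℕ => ℝ) (ENNReal.ofReal p)) (g i) j]
      refine (Real.rpow_le_rpow (norm_nonneg _) h1 hp0.le).trans ?_
      rw [Real.div_rpow hd.le (by norm_num)]
      refine div_le_div_of_nonneg_left (by positivity) (by norm_num) ?_
      simpa using Real.rpow_le_rpow_of_exponent_le (by norm_num : (1 : ℝ) ≤ 2) hp1.le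
  refine (chebRadius_le y (hR0.trans hRT'.le) fun x hx => ?_).trans_lt hTT'
  obtain ⟨z, hz, hxz⟩ : ∃ z ∈ F, dist x z < T' - R := by
    simpa using hAF hx
  have h1 : ‖z - y‖ < R := (Real.rpow_lt_rpow_iff (norm_nonneg _) hR0 hp0).1 (hy ⟨z, hz⟩)
  rw [← dist_eq_norm] at h1 ⊢
  linarith [dist_triangle x z y]
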